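/- Let α ∈ (0,1) and z > 0, and fix integers r ≥ 1 and s ≥ 1. Then lim_{n→∞} (-1)^{rs} (n)_{[rs]} binom(α,r)^s (-z)^s · (∑_{j=0}^{n-rs} 𝒞(n-rs,j;α) z^j) / (∑_{j=0}^{n} 𝒞(n,j;α) z^j) = (α (1-α)_{(r-1)} z / r!)^s. Consequently the s-th falling factorial moment of the number M_r(α,z,n) of blocks of size r under the NB-CPSM converges to the s-th falling factorial moment of a Poisson random variable with parameter α (1-α)_{(r-1)} z / r!, so M_r(α,z,n) converges weakly to that Poisson distribution. -/

import Mathlib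

open Finset Filter Real MeasureTheory Topology Set

/-- Ascending factorial `(x)_{(n)} = x (x+1) ⋯ (x+n-1)`. -/
noncomputable def ascFact (x : ℝ) (n : ℕ) : ℝ := ∏ i ∈ Finset.range n, (x + i)

/-- Falling factorial `(a)_{[n]} = a (a-1) ⋯ (a-n+1)`. -/
noncomputable def fallFact (a : ℝ) (n : ℕ) : ℝ := ∏ i ∈ Finset.range n, (a - i)

/-- Generalized factorial coefficient
`𝒞(n,j;α) = (1/j!) ∑_{i=0}^{j} C(j,i) (-1)^i (-iα)_{(n)}`. -/
noncomputable def genFact (n j : ℕ) (α : ℝ) : ℝ :=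
  (1 / (Nat.factorial j : ℝ)) *
    ∑ i ∈ Finset.range (j + 1), (Nat.choose j i : ℝ) * (-1) ^ i * ascFact (-(i * α)) n

/-- Generalized binomial coefficient `binom(a,r) = a(a-1)⋯(a-r+1)/r!`. -/
noncomputable def genBinom (a : ℝ) (r : ℕ) : ℝ := fallFact a r / (Nat.factorial r : ℝ)

lemma ascFact_succ (x : ℝ) (n : ℕ) : ascFact x (n + 1) = ascFact x n * (x + n) := by
  simp [ascFact, Finset.prod_range_succ]

lemma ascFact_succ' (x : ℝ) (n : ℕ) : ascFact x (n + 1) = x * ascFact (x + 1) n := by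
  simp only [ascFact, Finset.prod_range_succ']
  rw [mul_comm]
  congr 1
  · simp
  · refine Finset.prod_congr rfl fun i _ => ?_
    push_cast
    ring

lemma ascFact_pos {x : ℝ} (hx : 0 < x) (n : ℕ) : 0 < ascFact x n :=
  Finset.prod_pos fun _ _ => by positivity

/-- The Chu–Vandermonde identity for ascending factorials. -/
lemma ascFact_add (x y : ℝ) (n : ℕ) :
    ascFact (x + y) n =
      ∑ p ∈ antidiagonal n, (n.choose p.1 : ℝ) * (ascFact x p.1 * ascFact y p.2) := by
  induction n with
  | zero => simp [ascFact]
  | succ n ih =>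
    rw [Finset.sum_antidiagonal_choose_succ_mul (fun i j => ascFact x i * ascFact y j),
      ascFact_succ, ih, Finset.sum_mul, ← Finset.sum_add_distrib]
    refine Finset.sum_congr rfl fun p hp => ?_
    have hn : p.1 + p.2 = n := mem_antidiagonal.1 hp
    rw [← Nat.choose_symm_of_eq_add hn.symm, ascFact_succ, ascFact_succ, ← hn]
    push_cast
    ring

/-- A falling factorial of a negated argument, up to sign, is an ascending factorial. -/
lemma fallFact_eq (a : ℝ) (n : ℕ) : fallFact a n = (-1) ^ n * ascFact (-a) n := by
  induction n with
  | zero => simp [fallFact, ascFact]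
  | succ n ih =>
    rw [ascFact_succ, fallFact, Finset.prod_range_succ, ← fallFact, ih]
    ring

lemma fallFact_natCast_add (n m : ℕ) :
    fallFact ((n + m : ℕ) : ℝ) m * (n.factorial : ℝ) = ((n + m).factorial : ℝ) := by
  induction m with
  | zero => simp [fallFact]
  | succ m ih =>
    have h : fallFact ((n + (m + 1) : ℕ) : ℝ) (m + 1) =
        ((n + m + 1 : ℕ) : ℝ) * fallFact ((n + m : ℕ) : ℝ) m := by
      simp only [fallFact, Finset.prod_range_succ']
      rw [mul_comm]
      congr 1
      · push_cast; ring
      · refine Finset.prod_congr rfl fun i _ => ?_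
        push_cast
        ring
    rw [h, mul_assoc, ih, ← add_assoc, Nat.factorial_succ]
    push_cast
    ring

lemma genFact_zero_right (n : ℕ) (α : ℝ) : genFact (n + 1) 0 α = 0 := by
  simp [genFact, ascFact_succ']

lemma genFact_succ_succ (n j : ℕ) (α : ℝ) :
    genFact (n + 1) (j + 1) α =
      ∑ p ∈ antidiagonal n, (n.choose p.1 : ℝ) * (α * ascFact (1 - α) p.1) * genFact p.2 j α := by
  have hterm (i : ℕ) : ((j + 1).choose (i + 1) : ℝ) * (-1) ^ (i + 1) *
      ascFact (-((i + 1 : ℕ) * α)) (n + 1) =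
      (j + 1) * ∑ p ∈ antidiagonal n, (n.choose p.1 : ℝ) * (α * ascFact (1 - α) p.1) *
        ((j.choose i : ℝ) * (-1) ^ i * ascFact (-(i * α)) p.2) := by
    have hc : ((j + 1 : ℕ) : ℝ) * (j.choose i : ℝ) =
        ((j + 1).choose (i + 1) : ℝ) * ((i + 1 : ℕ) : ℝ) := by
      exact_mod_cast Nat.add_one_mul_choose_eq j i
    have hx : -(((i + 1 : ℕ) : ℝ) * α) + 1 = (1 - α) + -(i * α) := by push_cast; ring
    rw [ascFact_succ', hx, ascFact_add]
    calc _ = (((j + 1).choose (i + 1) : ℝ) * ((i + 1 : ℕ) : ℝ)) * ((-1) ^ i * α *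
          ∑ p ∈ antidiagonal n, (n.choose p.1 : ℝ) *
            (ascFact (1 - α) p.1 * ascFact (-(i * α)) p.2)) := by ring
      _ = _ := by
        rw [← hc, Finset.mul_sum, Finset.mul_sum, Finset.mul_sum]
        refine Finset.sum_congr rfl fun p _ => ?_
        push_cast
        ring
  rw [genFact, Finset.sum_range_succ', Finset.sum_congr rfl fun i _ => hterm i]
  simp only [genFact]
  rw [← Finset.mul_sum, Finset.sum_comm]
  have hj : ((j + 1).factorial : ℝ) = (j + 1) * j.factorial := by
    push_cast [Nat.factorial_succ]; ring
  have h0 : ascFact (-(((0 : ℕ) : ℝ) * α)) (n + 1) = 0 := by simp [ascFact_succ']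
  have hj' : (j : ℝ) + 1 ≠ 0 := by positivity
  rw [h0, hj, mul_zero, add_zero, ← mul_assoc]
  have : 1 / (((j : ℝ) + 1) * j.factorial) * (j + 1) = 1 / (j.factorial : ℝ) := by
    field_simp
  rw [this, Finset.mul_sum]
  refine Finset.sum_congr rfl fun p _ => ?_
  rw [← Finset.mul_sum]
  ring

lemma genFact_eq_zero_of_lt {n j : ℕ} (α : ℝ) (h : n < j) : genFact n j α = 0 := by
  induction j generalizing n with
  | zero => omega
  | succ j ih =>
    cases n with
    | zero =>
      have := Int.alternating_sum_range_choose_of_ne (n := j + 1) (by omega)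
      have h' : ∑ i ∈ Finset.range (j + 1 + 1), ((j + 1).choose i : ℝ) * (-1) ^ i = 0 := by
        rw [← Int.cast_zero, ← this]
        push_cast
        exact Finset.sum_congr rfl fun i _ => mul_comm _ _
      simp [genFact, ascFact, h']
    | succ n =>
      rw [genFact_succ_succ]
      refine Finset.sum_eq_zero fun p hp => ?_
      have := mem_antidiagonal.1 hp
      rw [ih (by omega), mul_zero]

/-- The normalizing sum `∑_{j ≤ n} 𝒞(n,j;α) z^j` of the NB-CPSM. -/
noncomputable def genFactSum (α z : ℝ) (n : ℕ) : ℝ :=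
  ∑ j ∈ Finset.range (n + 1), genFact n j α * z ^ j

lemma genFactSum_eq_sum_range (α z : ℝ) {n N : ℕ} (h : n ≤ N) :
    ∑ j ∈ Finset.range (N + 1), genFact n j α * z ^ j = genFactSum α z n := by
  refine (Finset.sum_subset (Finset.range_mono (by omega)) fun j _ hj => ?_).symm
  rw [genFact_eq_zero_of_lt α (by simpa using hj), zero_mul]

lemma genFactSum_succ (α z : ℝ) (n : ℕ) :
    genFactSum α z (n + 1) = z * ∑ p ∈ antidiagonal n,
      (n.choose p.1 : ℝ) * (α * ascFact (1 - α) p.1) * genFactSum α z p.2 := by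
  rw [genFactSum, Finset.sum_range_succ', genFact_zero_right, zero_mul, add_zero]
  simp only [genFact_succ_succ, Finset.sum_mul]
  rw [Finset.sum_comm, Finset.mul_sum]
  refine Finset.sum_congr rfl fun p hp => ?_
  have := mem_antidiagonal.1 hp
  rw [← genFactSum_eq_sum_range α z (show p.2 ≤ n by omega), Finset.mul_sum, Finset.mul_sum]
  exact Finset.sum_congr rfl fun j _ => by ring

/-- The coefficients of the power series of `α (1 - t) ^ (α - 1)`. -/
noncomputable def binomCoeff (α : ℝ) (k : ℕ) : ℝ := α * ascFact (1 - α) k / k.factorial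

/-- The coefficients of the power series of `exp (z (1 - (1 - t) ^ α))`. -/
noncomputable def expCoeff (α z : ℝ) (n : ℕ) : ℝ := genFactSum α z n / n.factorial

lemma binomCoeff_zero (α : ℝ) : binomCoeff α 0 = α := by simp [binomCoeff, ascFact]

lemma binomCoeff_succ (α : ℝ) (k : ℕ) :
    binomCoeff α (k + 1) = binomCoeff α k - α * (binomCoeff α k / (k + 1)) := by
  have : (k.factorial : ℝ) ≠ 0 := by positivity
  rw [binomCoeff, binomCoeff, ascFact_succ, Nat.factorial_succ]
  push_cast
  field_simp
  ring

lemma binomCoeff_pos {α : ℝ} (hα : α ∈ Set.Ioo (0 : ℝ) 1) (k : ℕ) : 0 < binomCoeff α k := by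
  have := ascFact_pos (sub_pos.2 hα.2) k
  have := hα.1
  unfold binomCoeff
  positivity

lemma expCoeff_succ (α z : ℝ) (n : ℕ) :
    (n + 1) * expCoeff α z (n + 1) =
      z * ∑ k ∈ Finset.range (n + 1), binomCoeff α k * expCoeff α z (n - k) := by
  rw [← Finset.Nat.sum_antidiagonal_eq_sum_range_succ
    (fun i j => binomCoeff α i * expCoeff α z j), expCoeff, genFactSum_succ, Nat.factorial_succ]
  have hn : (n.factorial : ℝ) ≠ 0 := by positivity
  push_cast
  rw [mul_div_assoc', mul_div_mul_left _ _ (by positivity), mul_div_assoc, Finset.sum_div]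
  congr 1
  refine Finset.sum_congr rfl fun p hp => ?_
  have hp := mem_antidiagonal.1 hp
  have h := Nat.choose_mul_factorial_mul_factorial (show p.1 ≤ n by omega)
  rw [show n - p.1 = p.2 by omega] at h
  have h1 : (p.1.factorial : ℝ) ≠ 0 := by positivity
  have h2 : (p.2.factorial : ℝ) ≠ 0 := by positivity
  have h : (n.choose p.1 : ℝ) * p.1.factorial * p.2.factorial = n.factorial := by exact_mod_cast h
  rw [binomCoeff, expCoeff, ← h]
  have h3 : (n.choose p.1 : ℝ) ≠ 0 := by
    exact_mod_cast (Nat.choose_pos (by omega)).ne'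
  field_simp

lemma expCoeff_pos {α z : ℝ} (hα : α ∈ Set.Ioo (0 : ℝ) 1) (hz : 0 < z) (n : ℕ) :
    0 < expCoeff α z n := by
  induction n using Nat.strong_induction_on with
  | _ n ih =>
    cases n with
    | zero => simp [expCoeff, genFactSum, genFact, ascFact]
    | succ n =>
      have h : 0 < (n + 1) * expCoeff α z (n + 1) := by
        rw [expCoeff_succ]
        refine mul_pos hz (Finset.sum_pos (fun k _ => ?_) (by simp))
        exact mul_pos (binomCoeff_pos hα k) (ih _ (by omega))
      exact pos_of_mul_pos_right h (by positivity)

lemma expCoeff_succ_succ (α z : ℝ) (n : ℕ) :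
    (n + 2) * expCoeff α z (n + 2) = (n + 1 + z * α) * expCoeff α z (n + 1) -
      z * α * ∑ k ∈ Finset.range (n + 1), binomCoeff α k / (k + 1) * expCoeff α z (n - k) := by
  have h1 := expCoeff_succ α z (n + 1)
  rw [Finset.sum_range_succ', binomCoeff_zero] at h1
  simp only [Nat.add_sub_add_right, binomCoeff_succ, sub_mul, Finset.sum_sub_distrib,
    Nat.sub_zero] at h1
  simp only [mul_assoc α, ← Finset.mul_sum] at h1
  push_cast at h1
  linear_combination h1 - expCoeff_succ α z n

lemma expCoeff_succ_succ_le {α z : ℝ} (hα : α ∈ Set.Ioo (0 : ℝ) 1) (hz : 0 < z) (n : ℕ) :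
    (n + 2) * expCoeff α z (n + 2) ≤ (n + 1 + z * α) * expCoeff α z (n + 1) := by
  rw [expCoeff_succ_succ, sub_le_self_iff]
  have := hα.1
  refine mul_nonneg (by positivity) (Finset.sum_nonneg fun k _ => ?_)
  have := binomCoeff_pos hα k
  have := expCoeff_pos hα hz (n - k)
  positivity

lemma expCoeff_le_succ {α z : ℝ} (hα : α ∈ Set.Ioo (0 : ℝ) 1) (hz : 0 < z) (n : ℕ) :
    expCoeff α z (n + 1) ≤ 2 / (1 - α) * expCoeff α z (n + 2) := by
  have h0 := hα.1
  have h1 := sub_pos.2 hα.2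
  have ha := expCoeff_pos hα hz (n + 1)
  have hb := expCoeff_pos hα hz (n + 2)
  have hsum : ∑ k ∈ Finset.range (n + 1), binomCoeff α k / (k + 1) * expCoeff α z (n - k) ≤
      ∑ k ∈ Finset.range (n + 1), binomCoeff α k * expCoeff α z (n - k) := by
    refine Finset.sum_le_sum fun k _ => ?_
    refine mul_le_mul_of_nonneg_right ?_ (expCoeff_pos hα hz _).le
    exact div_le_self (binomCoeff_pos hα k).le (by simp)
  have h2 := expCoeff_succ_succ α z n
  have h3 := mul_le_mul_of_nonneg_left hsum (mul_pos hz h0).le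
  have h4 : z * α * ∑ k ∈ Finset.range (n + 1), binomCoeff α k * expCoeff α z (n - k) =
      α * ((n + 1) * expCoeff α z (n + 1)) := by rw [expCoeff_succ]; ring
  have h5 : 0 < z * α * expCoeff α z (n + 1) := by positivity
  have h6 : (1 - α) * (n + 1) * expCoeff α z (n + 1) ≤ (n + 2) * expCoeff α z (n + 2) := by
    nlinarith
  rw [div_mul_eq_mul_div, le_div_iff₀ h1]
  have hn : (0 : ℝ) < n + 1 := by positivity
  refine le_of_mul_le_mul_left ?_ hn
  nlinarith [mul_nonneg (Nat.cast_nonneg (α := ℝ) n) hb.le]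

lemma expCoeff_le_add {α z : ℝ} (hα : α ∈ Set.Ioo (0 : ℝ) 1) (hz : 0 < z) (n j : ℕ) :
    expCoeff α z (n + 1) ≤ (2 / (1 - α)) ^ j * expCoeff α z (n + 1 + j) := by
  induction j with
  | zero => simp
  | succ j ih =>
    have h1 := sub_pos.2 hα.2
    refine ih.trans ?_
    rw [pow_succ, mul_assoc]
    refine mul_le_mul_of_nonneg_left ?_ (by positivity)
    simpa only [add_right_comm n 1 j, ← add_assoc] using expCoeff_le_succ hα hz (n + j)

lemma exists_le_expCoeff_succ_succ {α z : ℝ} (hα : α ∈ Set.Ioo (0 : ℝ) 1) (hz : 0 < z)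
    {K : ℕ} (hK : 1 ≤ K) :
    ∃ B : ℝ, ∀ n : ℕ, K ≤ n →
      ((1 - α / K) * (n + 1) + B) * expCoeff α z (n + 1) ≤ (n + 2) * expCoeff α z (n + 2) := by
  have h0 := hα.1
  have h1 := sub_pos.2 hα.2
  refine ⟨-(z * α * ∑ k ∈ Finset.range K, binomCoeff α k * (2 / (1 - α)) ^ (k + 1)),
    fun n hn => ?_⟩
  have ha := expCoeff_pos hα hz (n + 1)
  have hK' : (0 : ℝ) < K := by exact_mod_cast hK
  have hpos (k : ℕ) : 0 < binomCoeff α k * expCoeff α z (n - k) :=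
    mul_pos (binomCoeff_pos hα k) (expCoeff_pos hα hz _)
  have hhead : ∑ k ∈ Finset.range K, binomCoeff α k / (k + 1) * expCoeff α z (n - k) ≤
      (∑ k ∈ Finset.range K, binomCoeff α k * (2 / (1 - α)) ^ (k + 1)) *
        expCoeff α z (n + 1) := by
    rw [Finset.sum_mul]
    refine Finset.sum_le_sum fun k hk => ?_
    have hk := Finset.mem_range.1 hk
    obtain ⟨m, rfl⟩ : ∃ m, n = m + 1 + k := ⟨n - k - 1, by omega⟩
    rw [mul_assoc, Nat.add_sub_cancel]
    refine mul_le_mul (div_le_self (binomCoeff_pos hα k).le (by simp))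
      (expCoeff_le_add hα hz m (k + 1)) (expCoeff_pos hα hz _).le (binomCoeff_pos hα k).le
  have htail : ∑ k ∈ Finset.Ico K (n + 1), binomCoeff α k / (k + 1) * expCoeff α z (n - k) ≤
      (∑ k ∈ Finset.range (n + 1), binomCoeff α k * expCoeff α z (n - k)) / K := by
    rw [Finset.sum_div]
    refine (Finset.sum_le_sum fun k hk => ?_).trans
      (Finset.sum_le_sum_of_subset_of_nonneg (s := Finset.Ico K (n + 1)) ?_ fun k _ _ =>
        (div_pos (hpos k) hK').le)
    · have hk : (K : ℝ) ≤ k := by exact_mod_cast (Finset.mem_Ico.1 hk).1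
      rw [div_mul_eq_mul_div]
      exact div_le_div_of_nonneg_left (hpos k).le hK' (by linarith)
    · intro k hk
      simp only [Finset.mem_Ico, Finset.mem_range] at hk ⊢
      omega
  have hzα : 0 < z * α := by positivity
  have hsplit := Finset.sum_range_add_sum_Ico
    (fun k => binomCoeff α k / (k + 1) * expCoeff α z (n - k)) (show K ≤ n + 1 by omega)
  have hS : z * α * ((∑ k ∈ Finset.range (n + 1), binomCoeff α k * expCoeff α z (n - k)) / K) =
      α / K * ((n + 1) * expCoeff α z (n + 1)) := by rw [expCoeff_succ]; ring
  rw [expCoeff_succ_succ, ← hsplit]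
  have e1 := mul_le_mul_of_nonneg_left hhead hzα.le
  have e2 := mul_le_mul_of_nonneg_left htail hzα.le
  rw [hS] at e2
  have e3 := mul_pos hzα ha
  linarith

lemma tendsto_affine_div (c d : ℝ) :
    Tendsto (fun n : ℕ => (c * (n + 1) + d) / ((n : ℝ) + 2)) atTop (𝓝 c) := by
  have h : Tendsto (fun n : ℕ => c + (d - c) / ((n : ℝ) + 2)) atTop (𝓝 (c + 0)) :=
    tendsto_const_nhds.add (tendsto_const_nhds.div_atTop
      (tendsto_atTop_add_const_right _ _ tendsto_natCast_atTop_atTop))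
  rw [add_zero] at h
  refine h.congr fun n => ?_
  have : (n : ℝ) + 2 ≠ 0 := by positivity
  field_simp
  ring

lemma tendsto_expCoeff_succ_div {α z : ℝ} (hα : α ∈ Set.Ioo (0 : ℝ) 1) (hz : 0 < z) :
    Tendsto (fun n => expCoeff α z (n + 1) / expCoeff α z n) atTop (𝓝 1) := by
  rw [← tendsto_add_atTop_iff_nat 1]
  refine tendsto_order.2 ⟨fun c hc => ?_, fun c hc => ?_⟩
  · obtain ⟨K, hK⟩ := exists_nat_gt (α / (1 - c))
    have hc' := sub_pos.2 hc
    have hK0 : (0 : ℝ) < K := (div_pos hα.1 hc').trans hK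
    obtain ⟨B, hB⟩ := exists_le_expCoeff_succ_succ hα hz (K := K) (by exact_mod_cast hK0)
    have hlt : c < 1 - α / K := by
      rw [div_lt_comm₀ hc' hK0] at hK
      linarith
    filter_upwards [(tendsto_order.1 (tendsto_affine_div (1 - α / K) B)).1 c hlt,
      eventually_ge_atTop K] with n hn hKn
    refine hn.trans_le ?_
    rw [div_le_div_iff₀ (by positivity) (expCoeff_pos hα hz _)]
    linarith [hB n hKn]
  · filter_upwards [(tendsto_order.1 (tendsto_affine_div 1 (z * α))).2 c hc] with n hn
    refine lt_of_le_of_lt ?_ hn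
    rw [div_le_div_iff₀ (expCoeff_pos hα hz _) (by positivity)]
    linarith [expCoeff_succ_succ_le hα hz n]

lemma tendsto_expCoeff_div_add {α z : ℝ} (hα : α ∈ Set.Ioo (0 : ℝ) 1) (hz : 0 < z) (m : ℕ) :
    Tendsto (fun n => expCoeff α z n / expCoeff α z (n + m)) atTop (𝓝 1) := by
  induction m with
  | zero => simp [div_self (expCoeff_pos hα hz _).ne']
  | succ m ih =>
    have h := ((tendsto_add_atTop_iff_nat m).2 (tendsto_expCoeff_succ_div hα hz)).inv₀ one_ne_zero
    have h' := ih.mul h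
    rw [inv_one, mul_one] at h'
    refine h'.congr fun n => ?_
    rw [inv_div, div_mul_div_cancel₀ (expCoeff_pos hα hz _).ne', add_assoc]

lemma genBinom_succ (α : ℝ) (k : ℕ) :
    genBinom α (k + 1) = (-1) ^ k * (α * ascFact (1 - α) k) / (k + 1).factorial := by
  rw [genBinom, fallFact_eq, ascFact_succ', neg_add_eq_sub]
  ring

/-- for `α ∈ (0,1)`, `z > 0` and fixed `r, s ≥ 1`, the `s`-th falling factorial
moment of `M_r(α,z,n)` under the NB-CPSM converges to `(α (1-α)_{(r-1)} z / r!)^s`, the `s`-th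
falling factorial moment of a Poisson random variable with that parameter. -/
theorem nbcpsm_falling_factorial_moment_tendsto_pos
    (α z : ℝ) (hα : α ∈ Set.Ioo (0 : ℝ) 1) (hz : 0 < z)
    (r s : ℕ) (hr : 1 ≤ r) (hs : 1 ≤ s) :
    Tendsto (fun n : ℕ =>
        (-1 : ℝ) ^ (r * s) * fallFact (n : ℝ) (r * s) * (genBinom α r) ^ s * (-z) ^ s *
          ((∑ j ∈ Finset.range (n - r * s + 1), genFact (n - r * s) j α * z ^ j) /
           (∑ j ∈ Finset.range (n + 1), genFact n j α * z ^ j)))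
      atTop
      (𝓝 ((α * ascFact (1 - α) (r - 1) * z / (Nat.factorial r : ℝ)) ^ s)) := by
  rw [← tendsto_add_atTop_iff_nat (r * s)]
  have h := (tendsto_expCoeff_div_add hα hz (r * s)).const_mul
    ((α * ascFact (1 - α) (r - 1) * z / (Nat.factorial r : ℝ)) ^ s)
  rw [mul_one] at h
  refine h.congr fun n => ?_
  obtain ⟨k, rfl⟩ : ∃ k, r = k + 1 := ⟨r - 1, by omega⟩
  have hsign : (-1 : ℝ) ^ ((k + 1) * s) * (genBinom α (k + 1)) ^ s * (-z) ^ s =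
      (α * ascFact (1 - α) k * z / ((k + 1).factorial : ℝ)) ^ s := by
    rw [genBinom_succ, pow_mul, ← mul_pow, ← mul_pow]
    congr 1
    have : (-1 : ℝ) ^ k * (-1) ^ k = 1 := by rw [← mul_pow]; simp
    linear_combination (α * ascFact (1 - α) k * z / ((k + 1).factorial : ℝ)) * this
  have hfall := fallFact_natCast_add n ((k + 1) * s)
  rw [Nat.add_sub_cancel, Nat.add_sub_cancel, ← hsign, expCoeff, expCoeff, ← hfall]
  change _ = _ * (genFactSum α z n / genFactSum α z (n + (k + 1) * s))
  have hn : (n.factorial : ℝ) ≠ 0 := by positivity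
  have hf : fallFact ((n + (k + 1) * s : ℕ) : ℝ) ((k + 1) * s) ≠ 0 := by
    intro h0
    rw [h0, zero_mul] at hfall
    exact (Nat.factorial_ne_zero _) (by exact_mod_cast hfall.symm)
  rw [div_div_div_eq, mul_comm (fallFact _ _) (n.factorial : ℝ), mul_left_comm,
    mul_div_mul_left _ _ hn]
  ring
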